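/- Let A ∈ C₊ with A ≠ ∅ and A ≠ R̄₊ⁿ. Then the copolar is involutive on A: (A°)° = A. -/

import Mathlib

open Set MeasureTheory Pointwise

noncomputable section

abbrev En (n : ℕ) := EuclideanSpace ℝ (Fin n)

/-- Standard inner product on ℝⁿ. -/
def dotp {n : ℕ} (x y : En n) : ℝ := ∑ i, x i * y i

/-- Closed positive orthant R̄₊ⁿ. -/
def posOrthantCl (n : ℕ) : Set (En n) := {x | ∀ i, 0 ≤ x i}
/-- Open positive orthant R₊ⁿ. -/
def posOrthantOp (n : ℕ) : Set (En n) := {x | ∀ i, 0 < x i}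
/-- Closed negative orthant R̄₋ⁿ. -/
def negOrthantCl (n : ℕ) : Set (En n) := {x | ∀ i, x i ≤ 0}
/-- Open negative orthant R₋ⁿ. -/
def negOrthantOp (n : ℕ) : Set (En n) := {x | ∀ i, x i < 0}

/-- Copolar A° = {x : ⟨x,y⟩ ≤ −1 for all y ∈ A}. -/
def copolar {n : ℕ} (A : Set (En n)) : Set (En n) := {x | ∀ y ∈ A, dotp x y ≤ -1}

/-- Membership in C₊: closed convex subset of R̄₊ⁿ with A + R₊ⁿ ⊆ A. -/
def memCplus {n : ℕ} (A : Set (En n)) : Prop :=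
  IsClosed A ∧ Convex ℝ A ∧ A ⊆ posOrthantCl n ∧ A + posOrthantOp n ⊆ A

/-- Membership in C₋: closed convex subset of R̄₋ⁿ with A + R₋ⁿ ⊆ A. -/
def memCminus {n : ℕ} (A : Set (En n)) : Prop :=
  IsClosed A ∧ Convex ℝ A ∧ A ⊆ negOrthantCl n ∧ A + negOrthantOp n ⊆ A

/-- Membership in CC₊: member of C₊ with bounded complement in R̄₊ⁿ. -/
def memCCplus {n : ℕ} (P : Set (En n)) : Prop :=
  memCplus P ∧ Bornology.IsBounded (posOrthantCl n \ P)

/-- Membership in UC₋: nonempty member of C₋ contained in s* + R̄₋ⁿ for some s* ∈ R₋ⁿ. -/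
def memUCminus {n : ℕ} (L : Set (En n)) : Prop :=
  L.Nonempty ∧ memCminus L ∧ ∃ s ∈ negOrthantOp n, L ⊆ s +ᵥ negOrthantCl n

/-- Support function of a set, with values in EReal. -/
def suppFn {n : ℕ} (A : Set (En n)) (x : En n) : EReal := ⨆ y ∈ A, ((dotp x y : ℝ) : EReal)

/-- Legendre transform of an EReal-valued function. -/
def legendre {n : ℕ} (f : En n → EReal) (y : En n) : EReal :=
  ⨆ x, ((dotp x y : ℝ) : EReal) - f x

theorem dotp_eq_inner {n : ℕ} (x y : En n) : dotp x y = inner ℝ x y := by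
  simp [dotp, PiLp.inner_apply, mul_comm]

theorem dotp_comm {n : ℕ} (x y : En n) : dotp x y = dotp y x := by
  simp [dotp, mul_comm]

theorem subset_copolar_copolar {n : ℕ} (A : Set (En n)) : A ⊆ copolar (copolar A) :=
  fun x hx y hy => dotp_comm x y ▸ hy x hx

theorem memCplus.add_mem {n : ℕ} {A : Set (En n)} (hA : memCplus A) {y z : En n}
    (hy : y ∈ A) (hz : z ∈ posOrthantCl n) : y + z ∈ A := by
  obtain ⟨hcl, -, -, hadd⟩ := hA
  let u : En n := WithLp.toLp 2 fun _ => 1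
  have hlim : Filter.Tendsto (fun ε : ℝ => y + (z + ε • u)) (nhdsWithin 0 (Ioi 0))
      (nhds (y + z)) := by
    have hcont : Continuous fun ε : ℝ => y + (z + ε • u) := by fun_prop
    simpa using (hcont.tendsto 0).mono_left nhdsWithin_le_nhds
  refine hcl.mem_of_tendsto hlim ?_
  filter_upwards [self_mem_nhdsWithin] with ε hε
  refine hadd (Set.add_mem_add hy fun i => ?_)
  have hzi := hz i
  have hε' : 0 < ε := hε
  simp only [PiLp.add_apply, PiLp.smul_apply, smul_eq_mul, u]
  linarith

theorem memCplus.zero_notMem {n : ℕ} {A : Set (En n)} (hA : memCplus A)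
    (hne : A ≠ posOrthantCl n) : (0 : En n) ∉ A := fun h0 =>
  hne (hA.2.2.1.antisymm fun z hz => by simpa using hA.add_mem h0 hz)

theorem exists_dotp_lt_of_notMem {n : ℕ} {A : Set (En n)} (hconv : Convex ℝ A)
    (hcl : IsClosed A) {x : En n} (hx : x ∉ A) :
    ∃ (p : En n) (s : ℝ), (∀ y ∈ A, dotp p y < s) ∧ s < dotp p x := by
  obtain ⟨f, s, hfA, hfx⟩ := geometric_hahn_banach_closed_point hconv hcl hx
  refine ⟨(InnerProductSpace.toDual ℝ (En n)).symm f, s, fun y hy => ?_, ?_⟩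
  · simpa [dotp_eq_inner] using hfA y hy
  · simpa [dotp_eq_inner] using hfx

theorem smul_mem_copolar_of_lt {n : ℕ} {A : Set (En n)} {p : En n} {s : ℝ} (hs : s < 0)
    (hp : ∀ y ∈ A, dotp p y < s) : (-s)⁻¹ • p ∈ copolar A := by
  intro y hy
  have hy' := hp y hy
  rw [dotp_eq_inner, real_inner_smul_left, ← dotp_eq_inner, inv_mul_le_iff₀ (by linarith)]
  linarith

theorem memCplus.dotp_nonpos_of_bounded {n : ℕ} {A : Set (En n)} (hA : memCplus A)
    {p : En n} {s : ℝ} (hp : ∀ y ∈ A, dotp p y < s) {y : En n} (hy : y ∈ A) :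
    dotp p y ≤ 0 := by
  by_contra! hpos
  have ht : 0 ≤ |s| / dotp p y := by positivity
  have hmem : y + (|s| / dotp p y) • y ∈ A :=
    hA.add_mem hy fun i => by
      have := hA.2.2.1 hy i
      simpa using mul_nonneg ht this
  have h := hp _ hmem
  rw [dotp_eq_inner, inner_add_right, real_inner_smul_right, ← dotp_eq_inner,
    div_mul_cancel₀ _ hpos.ne'] at h
  linarith [le_abs_self s]

/-- For A ∈ C₊ with A ≠ ∅ and A ≠ R̄₊ⁿ, the copolar is involutive:
(A°)° = A. -/
theorem copolar_copolar_Cplus (n : ℕ) (hn : 1 ≤ n) (A : Set (En n))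
    (hA : memCplus A) (hne : A.Nonempty) (hne' : A ≠ posOrthantCl n) :
    copolar (copolar A) = A := by
  refine Subset.antisymm (fun x hx => ?_) (subset_copolar_copolar A)
  by_contra hxA
  obtain ⟨p, s, hpA, hpx⟩ := exists_dotp_lt_of_notMem hA.2.1 hA.1 hxA
  rcases lt_or_ge s 0 with hs | hs
  · have h := hx _ (smul_mem_copolar_of_lt hs hpA)
    rw [dotp_comm, dotp_eq_inner, real_inner_smul_left, ← dotp_eq_inner,
      inv_mul_le_iff₀ (by linarith)] at h
    linarith
  · obtain ⟨q, r, hqA, hq0⟩ := exists_dotp_lt_of_notMem hA.2.1 hA.1 (hA.zero_notMem hne')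
    have hr : r < 0 := by simpa [dotp_eq_inner] using hq0
    obtain ⟨v, hvA⟩ : (copolar A).Nonempty := ⟨_, smul_mem_copolar_of_lt hr hqA⟩
    have hpos : 0 < dotp p x := hs.trans_lt hpx
    have hmem : v + (|dotp v x| / dotp p x) • p ∈ copolar A := fun y hy => by
      have hle := hA.dotp_nonpos_of_bounded hpA hy
      have hmul := mul_nonpos_of_nonneg_of_nonpos
        (show 0 ≤ |dotp v x| / dotp p x by positivity) hle
      rw [dotp_eq_inner, inner_add_left, real_inner_smul_left, ← dotp_eq_inner,
        ← dotp_eq_inner]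
      linarith [hvA y hy]
    have h := hx _ hmem
    rw [dotp_comm, dotp_eq_inner, inner_add_left, real_inner_smul_left, ← dotp_eq_inner,
      ← dotp_eq_inner, div_mul_cancel₀ _ hpos.ne'] at h
    linarith [neg_abs_le (dotp v x)]
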